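/- Let c₁, c₂, c₃ be real numbers such that ρ(c₁,c₂,c₃) is positive semidefinite and 0 < max(|c₁|, |c₂|) < |c₃|. Then the symmetric local amplitude damping channel strictly decreases the RSP-fidelity for every nontrivial parameter: for all p ∈ (0,1], F_RSP(Φ_p(ρ(c₁,c₂,c₃))) < F_RSP(ρ(c₁,c₂,c₃)). -/

import Mathlib

open Matrix Kronecker ComplexOrder

noncomputable section

def pauli : Fin 3 → Matrix (Fin 2) (Fin 2) ℂ :=
  ![!![0, 1; 1, 0], !![0, -Complex.I; Complex.I, 0], !![1, 0; 0, -1]]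

def corr (ρ : Matrix (Fin 2 × Fin 2) (Fin 2 × Fin 2) ℂ) : Matrix (Fin 3) (Fin 3) ℝ :=
  Matrix.of fun k l => (Matrix.trace (ρ * (pauli k ⊗ₖ pauli l))).re

def lambdaMax (M : Matrix (Fin 3) (Fin 3) ℝ) : ℝ :=
  sSup {x : ℝ | ∃ v : Fin 3 → ℝ, v ≠ 0 ∧ M.mulVec v = x • v}

def Frsp (ρ : Matrix (Fin 2 × Fin 2) (Fin 2 × Fin 2) ℂ) : ℝ :=
  (1 / 2) * (Matrix.trace ((corr ρ)ᵀ * corr ρ) - lambdaMax ((corr ρ)ᵀ * corr ρ))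

def damp (p : ℝ) : Fin 2 → Matrix (Fin 2) (Fin 2) ℂ :=
  ![!![1, 0; 0, (Real.sqrt (1 - p) : ℂ)], !![0, (Real.sqrt p : ℂ); 0, 0]]

def Phi (p : ℝ) (ρ : Matrix (Fin 2 × Fin 2) (Fin 2 × Fin 2) ℂ) :
    Matrix (Fin 2 × Fin 2) (Fin 2 × Fin 2) ℂ :=
  ∑ i : Fin 2, ∑ j : Fin 2, (damp p i ⊗ₖ damp p j) * ρ * (damp p i ⊗ₖ damp p j)ᴴ

def bellDiag (c₁ c₂ c₃ : ℝ) : Matrix (Fin 2 × Fin 2) (Fin 2 × Fin 2) ℂ :=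
  (1 / 4 : ℂ) • (1 + (c₁ : ℂ) • (pauli 0 ⊗ₖ pauli 0) + (c₂ : ℂ) • (pauli 1 ⊗ₖ pauli 1)
    + (c₃ : ℂ) • (pauli 2 ⊗ₖ pauli 2))

def bloch (ρ : Matrix (Fin 2 × Fin 2) (Fin 2 × Fin 2) ℂ) : Fin 3 → ℝ :=
  fun k => (Matrix.trace (ρ * (pauli k ⊗ₖ (1 : Matrix (Fin 2) (Fin 2) ℂ)))).re

def Dg (ρ : Matrix (Fin 2 × Fin 2) (Fin 2 × Fin 2) ℂ) : ℝ :=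
  (1 / 2) * ((∑ k, bloch ρ k ^ 2) + Matrix.trace (corr ρ * (corr ρ)ᵀ)
    - lambdaMax (Matrix.vecMulVec (bloch ρ) (bloch ρ) + corr ρ * (corr ρ)ᵀ))

/-- The single-qubit amplitude damping channel. -/
def ampDamp (p : ℝ) (A : Matrix (Fin 2) (Fin 2) ℂ) : Matrix (Fin 2) (Fin 2) ℂ :=
  ∑ i : Fin 2, damp p i * A * (damp p i)ᴴ

lemma Phi_kronecker (p : ℝ) (A B : Matrix (Fin 2) (Fin 2) ℂ) :
    Phi p (A ⊗ₖ B) = ampDamp p A ⊗ₖ ampDamp p B := by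
  simp only [Phi, ampDamp, Fin.sum_univ_two, conjTranspose_kronecker, ← mul_kronecker_mul,
    add_kronecker, kronecker_add]
  abel

lemma Phi_add (p : ℝ) (ρ τ : Matrix (Fin 2 × Fin 2) (Fin 2 × Fin 2) ℂ) :
    Phi p (ρ + τ) = Phi p ρ + Phi p τ := by
  simp only [Phi, Matrix.mul_add, Matrix.add_mul, Finset.sum_add_distrib]

lemma Phi_smul (p : ℝ) (a : ℂ) (ρ : Matrix (Fin 2 × Fin 2) (Fin 2 × Fin 2) ℂ) :
    Phi p (a • ρ) = a • Phi p ρ := by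
  simp only [Phi, Matrix.mul_smul, Matrix.smul_mul, Finset.smul_sum]

lemma ampDamp_of {p : ℝ} (hp : 0 ≤ p) (hp1 : p ≤ 1) (a b c d : ℂ) :
    ampDamp p !![a, b; c, d] =
      !![a + p * d, (Real.sqrt (1 - p) : ℂ) * b;
        (Real.sqrt (1 - p) : ℂ) * c, (1 - p) * d] := by
  have h₁ : (Real.sqrt p : ℂ) * (Real.sqrt p : ℂ) = p := by
    rw [← Complex.ofReal_mul, Real.mul_self_sqrt hp]
  have h₂ : (Real.sqrt (1 - p) : ℂ) * (Real.sqrt (1 - p) : ℂ) = 1 - p := by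
    rw [← Complex.ofReal_mul, Real.mul_self_sqrt (by linarith)]
    push_cast
    rfl
  ext i j
  fin_cases i <;> fin_cases j <;>
    simp [ampDamp, damp, Matrix.vecMul, dotProduct, Fin.sum_univ_two] <;>
    first
      | ring1
      | linear_combination d * h₁
      | linear_combination d * h₂

lemma one_eq_kronecker : (1 : Matrix (Fin 2 × Fin 2) (Fin 2 × Fin 2) ℂ) =
    !![1, 0; 0, 1] ⊗ₖ !![1, 0; 0, 1] := by
  rw [← Matrix.one_fin_two, Matrix.one_kronecker_one]

lemma corr_bellDiag (c₁ c₂ c₃ : ℝ) :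
    corr (bellDiag c₁ c₂ c₃) = diagonal ![c₁, c₂, c₃] := by
  ext k l
  simp only [corr, bellDiag, one_eq_kronecker, of_apply, Matrix.smul_mul, Matrix.add_mul,
    ← mul_kronecker_mul, trace_smul, trace_add, trace_kronecker]
  fin_cases k <;> fin_cases l <;>
    simp [pauli, Matrix.trace_fin_two] <;> ring

lemma corr_Phi_bellDiag {p : ℝ} (hp : 0 ≤ p) (hp1 : p ≤ 1) (c₁ c₂ c₃ : ℝ) :
    corr (Phi p (bellDiag c₁ c₂ c₃)) =
      diagonal ![(1 - p) * c₁, (1 - p) * c₂, p ^ 2 + (1 - p) ^ 2 * c₃] := by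
  have hs : Real.sqrt (1 - p) * Real.sqrt (1 - p) = 1 - p :=
    Real.mul_self_sqrt (by linarith)
  have e₀ : ampDamp p (pauli 0) = _ := ampDamp_of hp hp1 0 1 1 0
  have e₁ : ampDamp p (pauli 1) = _ := ampDamp_of hp hp1 0 (-Complex.I) Complex.I 0
  have e₂ : ampDamp p (pauli 2) = _ := ampDamp_of hp hp1 1 0 0 (-1)
  ext k l
  simp only [corr, bellDiag, one_eq_kronecker, Phi_smul, Phi_add, Phi_kronecker, e₀, e₁, e₂,
    ampDamp_of hp hp1, of_apply, Matrix.smul_mul, Matrix.add_mul, ← mul_kronecker_mul,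
    trace_smul, trace_add, trace_kronecker]
  fin_cases k <;> fin_cases l <;>
    simp [pauli, Matrix.trace_fin_two] <;>
    first
      | ring1
      | linear_combination c₁ * hs
      | linear_combination c₂ * hs

/-- An eigenvalue of a diagonal matrix is one of the diagonal entries. -/
lemma exists_eq_of_diagonal_mulVec {d v : Fin 3 → ℝ} {x : ℝ} (hv : v ≠ 0)
    (h : (diagonal d).mulVec v = x • v) : ∃ i, x = d i := by
  obtain ⟨i, hi⟩ := Function.ne_iff.mp hv
  refine ⟨i, ?_⟩
  have := congrFun h i
  rw [mulVec_diagonal] at this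
  exact (mul_right_cancel₀ hi this).symm

lemma diagonal_mulVec_single_one (d : Fin 3 → ℝ) (i : Fin 3) :
    (diagonal d).mulVec (Pi.single i 1) = d i • Pi.single i 1 := by
  ext j
  by_cases h : j = i
  · subst h
    simp
  · simp [h]

lemma le_lambdaMax_diagonal (d : Fin 3 → ℝ) (i : Fin 3) : d i ≤ lambdaMax (diagonal d) := by
  refine le_csSup ((Set.finite_range d).bddAbove.mono ?_)
    ⟨Pi.single i 1, by simp, diagonal_mulVec_single_one d i⟩
  rintro x ⟨v, hv, h⟩
  obtain ⟨j, rfl⟩ := exists_eq_of_diagonal_mulVec hv h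
  exact Set.mem_range_self j

lemma lambdaMax_diagonal {d : Fin 3 → ℝ} {i : Fin 3} (hd : ∀ j, d j ≤ d i) :
    lambdaMax (diagonal d) = d i := by
  refine le_antisymm (csSup_le ⟨d i, Pi.single i 1, by simp, diagonal_mulVec_single_one d i⟩ ?_)
    (le_lambdaMax_diagonal d i)
  rintro x ⟨v, hv, h⟩
  obtain ⟨j, rfl⟩ := exists_eq_of_diagonal_mulVec hv h
  exact hd j

/-- When 0 < max(|c₁|,|c₂|) < |c₃|, every nontrivial symmetric local amplitude damping
channel strictly decreases the RSP-fidelity of the Bell-diagonal state. -/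
theorem frsp_strictly_decreases
    (c₁ c₂ c₃ : ℝ) (hpsd : (bellDiag c₁ c₂ c₃).PosSemidef)
    (hcpos : 0 < max |c₁| |c₂|) (hlt : max |c₁| |c₂| < |c₃|) :
    ∀ p ∈ Set.Ioc (0 : ℝ) 1,
      Frsp (Phi p (bellDiag c₁ c₂ c₃)) < Frsp (bellDiag c₁ c₂ c₃) := by
  rintro p ⟨hp, hp1⟩
  obtain ⟨h₁, h₂⟩ := max_lt_iff.mp hlt
  have hpos : 0 < c₁ ^ 2 + c₂ ^ 2 := by
    rcases lt_max_iff.mp hcpos with h | h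
    · have := sq_pos_of_ne_zero (abs_pos.mp h)
      positivity
    · have := sq_pos_of_ne_zero (abs_pos.mp h)
      positivity
  have hmax : lambdaMax (diagonal fun i => ![c₁, c₂, c₃] i * ![c₁, c₂, c₃] i) = c₃ * c₃ := by
    refine lambdaMax_diagonal (i := 2) fun j => ?_
    have := sq_lt_sq.mpr h₁
    have := sq_lt_sq.mpr h₂
    fin_cases j <;> simp <;> nlinarith
  have hle := le_lambdaMax_diagonal (fun i =>
    ![(1 - p) * c₁, (1 - p) * c₂, p ^ 2 + (1 - p) ^ 2 * c₃] i *
      ![(1 - p) * c₁, (1 - p) * c₂, p ^ 2 + (1 - p) ^ 2 * c₃] i) 2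
  have hq : (1 - p) ^ 2 * (c₁ ^ 2 + c₂ ^ 2) < c₁ ^ 2 + c₂ ^ 2 :=
    mul_lt_of_lt_one_left hpos (by nlinarith)
  simp only [Frsp, corr_bellDiag, corr_Phi_bellDiag hp.le hp1, diagonal_transpose,
    diagonal_mul_diagonal, hmax, trace_diagonal, Fin.sum_univ_three]
  simp only [cons_val] at hle ⊢
  linarith

end
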